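/- Let d be a positive integer and let f : ℝ^d → ℝ be twice continuously differentiable with ‖D²f(x)‖ ≤ K (operator norm of the second derivative, i.e., the norm of the second iterated Fréchet derivative) for all x ∈ ℝ^d, and let δ > 0. Then for every x ∈ ℝ^d, | δ^{−d}·∫_{ℝ^d} Φ((x − y)/δ)·f(y) dy − f(x) | ≤ K·d·δ²/12, where Φ(u) = ∏_{n=1}^d max(0, 1 − |u_n|). -/

import Mathlib

open MeasureTheory Finset

theorem abs_taylor_remainder_le {E : Type*} [NormedAddCommGroup E] [NormedSpace ℝ E]
    {f : E → ℝ} (hf : ContDiff ℝ 2 f) {K : ℝ} (hK : ∀ x, ‖iteratedFDeriv ℝ 2 f x‖ ≤ K)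
    (x v : E) : |f (x + v) - f x - fderiv ℝ f x v| ≤ K / 2 * ‖v‖ ^ 2 := by
  have hf' : Differentiable ℝ (fderiv ℝ f) :=
    (hf.fderiv_right (m := 1) (by norm_num)).differentiable one_ne_zero
  have hK' : ∀ y, ‖fderiv ℝ (fderiv ℝ f) y‖ ≤ K := fun y ↦ by
    rw [← norm_iteratedFDeriv_one, norm_iteratedFDeriv_fderiv]
    exact hK y
  have hlip (w : E) : ‖fderiv ℝ f (x + w) - fderiv ℝ f x‖ ≤ K * ‖w‖ := by
    simpa using convex_univ.norm_image_sub_le_of_norm_fderiv_le (𝕜 := ℝ)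
      (fun y _ ↦ hf' y) (fun y _ ↦ hK' y) (Set.mem_univ x) (Set.mem_univ (x + w))
  have hder (t : ℝ) : HasDerivAt (fun t : ℝ ↦ f (x + t • v) - f x - t * fderiv ℝ f x v)
      (fderiv ℝ f (x + t • v) v - fderiv ℝ f x v) t := by
    have hline : HasDerivAt (fun t : ℝ ↦ x + t • v) v t := by
      simpa using ((hasDerivAt_id t).smul_const v).const_add x
    have hcomp := ((hf.differentiable two_ne_zero (x + t • v)).hasFDerivAt).comp_hasDerivAt t hline
    exact ((hcomp.sub_const (f x)).sub ((hasDerivAt_id t).mul_const (fderiv ℝ f x v))).congr_deriv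
      (by simp)
  have hbound := image_norm_le_of_norm_deriv_right_le_deriv_boundary (a := 0) (b := 1)
    (B := fun t ↦ K / 2 * ‖v‖ ^ 2 * t ^ 2) (B' := fun t ↦ K * ‖v‖ ^ 2 * t)
    (fun t _ ↦ (hder t).continuousAt.continuousWithinAt)
    (fun t _ ↦ (hder t).hasDerivWithinAt) (by simp)
    (fun t ↦ by
      refine ((hasDerivAt_pow 2 t).const_mul (K / 2 * ‖v‖ ^ 2)).congr_deriv ?_
      push_cast
      ring)
    (fun t ht ↦ by
      calc ‖fderiv ℝ f (x + t • v) v - fderiv ℝ f x v‖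
          ≤ ‖fderiv ℝ f (x + t • v) - fderiv ℝ f x‖ * ‖v‖ :=
            (fderiv ℝ f (x + t • v) - fderiv ℝ f x).le_opNorm v
        _ ≤ K * ‖t • v‖ * ‖v‖ := by gcongr; exact hlip _
        _ = K * ‖v‖ ^ 2 * t := by
            rw [norm_smul, Real.norm_of_nonneg ht.1]
            ring)
    (Set.right_mem_Icc.2 zero_le_one)
  simpa using hbound

theorem integral_triangular_mul_abs_pow (k : ℕ) :
    ∫ t : ℝ, max 0 (1 - |t|) * |t| ^ k = 2 * ((k + 1 : ℝ)⁻¹ - (k + 2 : ℝ)⁻¹) := by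
  rw [integral_comp_abs (f := fun t ↦ max 0 (1 - t) * t ^ k)]
  congr 1
  rw [setIntegral_eq_of_subset_of_forall_sdiff_eq_zero measurableSet_Ioi
    (s := Set.Ioc (0 : ℝ) 1) Set.Ioc_subset_Ioi_self]
  · rw [setIntegral_congr_fun (g := fun t : ℝ ↦ t ^ k - t ^ (k + 1)) measurableSet_Ioc]
    · rw [← intervalIntegral.integral_of_le zero_le_one, intervalIntegral.integral_sub
        (by simp) (by simp)]
      simp only [integral_pow]
      push_cast
      simp
      ring
    · intro t ht
      simp only [max_eq_right (sub_nonneg.2 ht.2)]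
      ring
  · rintro t ⟨ht₀, ht₁⟩
    have : 1 ≤ t := by
      by_contra! h
      exact ht₁ ⟨ht₀, h.le⟩
    simp [max_eq_left (sub_nonpos.2 this)]

theorem integral_euclidean_prod {ι : Type*} [Fintype ι] (g : ι → ℝ → ℝ) :
    ∫ u : EuclideanSpace ℝ ι, ∏ n, g n (u n) = ∏ n, ∫ t, g n t := by
  rw [← integral_fintype_prod_volume_eq_prod]
  exact (EuclideanSpace.volume_preserving_symm_measurableEquiv_toLp ι).integral_comp'
    (fun u : ι → ℝ ↦ ∏ n, g n (u n))

/-- The tensor-product triangular kernel on Euclidean space. -/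
def tensorTriangular {ι : Type*} [Fintype ι] (u : EuclideanSpace ℝ ι) : ℝ :=
  ∏ n, max 0 (1 - |u n|)

namespace tensorTriangular

variable {ι : Type*} [Fintype ι]

theorem nonneg (u : EuclideanSpace ℝ ι) : 0 ≤ tensorTriangular u :=
  prod_nonneg fun _ _ ↦ le_max_left _ _

theorem neg (u : EuclideanSpace ℝ ι) : tensorTriangular (-u) = tensorTriangular u := by
  simp [tensorTriangular]

theorem continuous : Continuous (tensorTriangular : EuclideanSpace ℝ ι → ℝ) := by
  unfold tensorTriangular
  fun_prop

theorem hasCompactSupport :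
    HasCompactSupport (tensorTriangular : EuclideanSpace ℝ ι → ℝ) := by
  refine HasCompactSupport.intro (isCompact_closedBall 0 √(Fintype.card ι)) fun u hu ↦ ?_
  contrapose! hu
  rw [mem_closedBall_zero_iff]
  refine Real.le_sqrt_of_sq_le ?_
  rw [EuclideanSpace.real_norm_sq_eq]
  have hcoord (n : ι) : u n ^ 2 ≤ 1 := by
    rw [sq_le_one_iff_abs_le_one]
    by_contra! h
    exact hu (prod_eq_zero (mem_univ n) (max_eq_left (sub_nonpos.2 h.le)))
  simpa using sum_le_sum fun n (_ : n ∈ univ) ↦ hcoord n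

theorem integrable_mul {g : EuclideanSpace ℝ ι → ℝ} (hg : Continuous g) :
    Integrable fun u ↦ tensorTriangular u * g u :=
  (continuous.mul hg).integrable_of_hasCompactSupport hasCompactSupport.mul_right

theorem integral_eq_one : ∫ u : EuclideanSpace ℝ ι, tensorTriangular u = 1 := by
  have h := integral_triangular_mul_abs_pow 0
  norm_num at h
  simp only [tensorTriangular]
  rw [integral_euclidean_prod fun (_ : ι) t ↦ max 0 (1 - |t|)]
  simp [h]

theorem integral_mul_coord_sq (n : ι) :
    ∫ u : EuclideanSpace ℝ ι, tensorTriangular u * u n ^ 2 = 1 / 6 := by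
  classical
  have h₀ := integral_triangular_mul_abs_pow 0
  have h₂ := integral_triangular_mul_abs_pow 2
  norm_num at h₀ h₂
  have hprod (u : EuclideanSpace ℝ ι) : tensorTriangular u * u n ^ 2 =
      ∏ m, max 0 (1 - |u m|) * (if m = n then u m ^ 2 else 1) := by
    rw [prod_mul_distrib, prod_ite_eq' univ n, if_pos (mem_univ n), tensorTriangular]
  simp only [hprod]
  rw [integral_euclidean_prod fun m t ↦ max 0 (1 - |t|) * (if m = n then t ^ 2 else 1),
    prod_eq_single n]
  · simpa using h₂
  · intro m _ hm
    simpa [hm] using h₀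
  · simp

theorem integral_mul_norm_sq :
    ∫ u : EuclideanSpace ℝ ι, tensorTriangular u * ‖u‖ ^ 2 = Fintype.card ι / 6 := by
  simp only [EuclideanSpace.real_norm_sq_eq, mul_sum]
  rw [integral_finsetSum _ fun n _ ↦ integrable_mul (by fun_prop)]
  simp [integral_mul_coord_sq, div_eq_mul_inv]

theorem integral_mul_clm (L : EuclideanSpace ℝ ι →L[ℝ] ℝ) :
    ∫ u, tensorTriangular u * L u = 0 := by
  have h := integral_neg_eq_self (fun u ↦ tensorTriangular u * L u) volume
  simp only [neg, map_neg, mul_neg, integral_neg] at h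
  linarith

theorem smoothing_eq (f : EuclideanSpace ℝ ι → ℝ) {δ : ℝ} (hδ : 0 < δ)
    (x : EuclideanSpace ℝ ι) :
    (δ ^ Fintype.card ι)⁻¹ * ∫ y, tensorTriangular (δ⁻¹ • (x - y)) * f y =
      ∫ u, tensorTriangular u * f (x + (-δ) • u) := by
  have hsub := integral_sub_left_eq_self
    (fun y ↦ tensorTriangular (δ⁻¹ • (x - y)) * f y) volume x
  have hscale := Measure.integral_comp_smul volume
    (fun z ↦ tensorTriangular (δ⁻¹ • z) * f (x - z)) δ
  simp only [sub_sub_cancel] at hsub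
  simp only [inv_smul_smul₀ hδ.ne', finrank_euclideanSpace, smul_eq_mul] at hscale
  rw [abs_of_pos (by positivity)] at hscale
  simp only [neg_smul, ← sub_eq_add_neg]
  rw [← hsub, hscale]

theorem abs_smoothing_sub_le {f : EuclideanSpace ℝ ι → ℝ} (hf : ContDiff ℝ 2 f) {K : ℝ}
    (hK : ∀ x, ‖iteratedFDeriv ℝ 2 f x‖ ≤ K) (x : EuclideanSpace ℝ ι) (c : ℝ) :
    |(∫ u, tensorTriangular u * f (x + c • u)) - f x| ≤ K * Fintype.card ι * c ^ 2 / 12 := by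
  have hcont := hf.continuous
  have hremainder : (∫ u, tensorTriangular u * f (x + c • u)) - f x =
      ∫ u, tensorTriangular u * (f (x + c • u) - f x - fderiv ℝ f x (c • u)) := by
    have hvalue : Integrable fun u ↦ tensorTriangular u * f (x + c • u) :=
      integrable_mul (by fun_prop)
    have hconst : Integrable fun u : EuclideanSpace ℝ ι ↦ tensorTriangular u * f x :=
      integrable_mul (by fun_prop)
    have hlinear : Integrable fun u ↦ tensorTriangular u * fderiv ℝ f x (c • u) :=
      integrable_mul (by fun_prop)
    simp only [mul_sub]
    rw [integral_sub (by exact hvalue.sub hconst) hlinear, integral_sub hvalue hconst,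
      integral_mul_const, integral_eq_one, one_mul]
    have hlin := integral_mul_clm (c • fderiv ℝ f x)
    simp only [smul_apply] at hlin
    simp only [map_smul, hlin, sub_zero]
  rw [hremainder, ← Real.norm_eq_abs]
  calc ‖∫ u, tensorTriangular u * (f (x + c • u) - f x - fderiv ℝ f x (c • u))‖
      ≤ ∫ u : EuclideanSpace ℝ ι, K / 2 * c ^ 2 * (tensorTriangular u * ‖u‖ ^ 2) := by
        refine norm_integral_le_of_norm_le ((integrable_mul (by fun_prop)).const_mul _)
          (.of_forall fun u ↦ ?_)
        rw [norm_mul, Real.norm_of_nonneg (nonneg u), Real.norm_eq_abs]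
        refine (mul_le_mul_of_nonneg_left (abs_taylor_remainder_le hf hK x (c • u))
          (nonneg u)).trans_eq ?_
        rw [norm_smul, mul_pow, Real.norm_eq_abs, sq_abs]
        ring
    _ = K * Fintype.card ι * c ^ 2 / 12 := by
        rw [integral_const_mul, integral_mul_norm_sq]
        ring

end tensorTriangular

theorem tensor_triangular_kernel_bias_C2
    (d : ℕ) (hd : 0 < d)
    (f : EuclideanSpace ℝ (Fin d) → ℝ) (hf : ContDiff ℝ 2 f)
    (K : ℝ) (hK : ∀ x : EuclideanSpace ℝ (Fin d), ‖iteratedFDeriv ℝ 2 f x‖ ≤ K)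
    (δ : ℝ) (hδ : 0 < δ)
    (Φ : EuclideanSpace ℝ (Fin d) → ℝ)
    (hΦ : ∀ u, Φ u = ∏ n : Fin d, max 0 (1 - |u n|)) :
    ∀ x : EuclideanSpace ℝ (Fin d),
      |(δ ^ d)⁻¹ * (∫ y : EuclideanSpace ℝ (Fin d), Φ (δ⁻¹ • (x - y)) * f y) - f x|
        ≤ K * d * δ ^ 2 / 12 := by
  intro x
  obtain rfl : Φ = tensorTriangular := funext hΦ
  have hsmooth := tensorTriangular.smoothing_eq f hδ x
  rw [Fintype.card_fin] at hsmooth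
  rw [hsmooth]
  simpa using tensorTriangular.abs_smoothing_sub_le hf hK x (-δ)
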